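/- arXiv:2506.14734 — 3 statements merged into one kernel-verified Lean document; each statement's English description precedes it below -/
import Mathlib

section
/- Let T be a text of length n over a finite totally ordered alphabet Σ, let π be an order-preserving permutation for T, and let m ≥ 1. For every position j ∈ [n] with j + m − 1 ≤ n and LPF_π[j] ≥ m, there exists exactly one irreducible LPF_π position i with LPF_π[i] > 0 such that i ≤ j ≤ i + ℓ_i − 1 and j + m − 1 ≤ i + LPF_π[i] − 1, where ℓ_i is the reducible-prefix length of the phrase starting at i. -/
/-!
Common definitions: strings are modeled as functions `S : ℕ → A` with 1-based
positions `1,…,n`; patterns/substrings as `List A`.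
-/

open scoped Classical

/-- Length of the longest common prefix of the suffixes `S[i,n]` and `S[j,n]`
(1-based indexing): the largest `k` with `i+k-1 ≤ n`, `j+k-1 ≤ n` and
`S[i,i+k-1] = S[j,j+k-1]`. -/
noncomputable def rlce {A : Type*} (S : ℕ → A) (n i j : ℕ) : ℕ :=
  Nat.findGreatest
    (fun k => i + k ≤ n + 1 ∧ j + k ≤ n + 1 ∧ ∀ t < k, S (i + t) = S (j + t)) n

/-- `π` is order-preserving for the string `S[1,n]`: whenever `π i < π j` and
`S[i,i+1] = S[j,j+1]` (for `i, j ∈ [n-1]`), also `π (i+1) < π (j+1)`. -/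
def OrderPres {A : Type*} (S : ℕ → A) (n : ℕ) (π : ℕ → ℕ) : Prop :=
  ∀ i j, 1 ≤ i → i < n → 1 ≤ j → j < n → π i < π j →
    S i = S j → S (i + 1) = S (j + 1) → π (i + 1) < π (j + 1)

/-- `π` is a permutation of `{1,…,n}`. -/
def PermOn (π : ℕ → ℕ) (n : ℕ) : Prop :=
  Set.BijOn π (Set.Icc 1 n) (Set.Icc 1 n)

/-- Generalized Longest Previous Factor array `LPF_π` of `S[1,n]`:
`LPF_π[i] = 0` if `π i = 1`, and `LPF_π[i] = max { rlce(j,i) : j ∈ [n], π j < π i }`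
otherwise. -/
noncomputable def LPF {A : Type*} (S : ℕ → A) (n : ℕ) (π : ℕ → ℕ) (i : ℕ) : ℕ :=
  if π i = 1 then 0
  else ((Finset.Icc 1 n).filter (fun j => π j < π i)).sup (fun j => rlce S n j i)

/-- `i` is an irreducible `LPF_π` position: `i = 1` or `LPF_π[i] ≠ LPF_π[i-1] - 1`
(the right-hand side taken over the integers). -/
def Irr {A : Type*} (S : ℕ → A) (n : ℕ) (π : ℕ → ℕ) (i : ℕ) : Prop :=
  i = 1 ∨ (LPF S n π i : ℤ) ≠ (LPF S n π (i - 1) : ℤ) - 1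

/-- The Path Decomposition Array `PDA_π = { i + LPF_π[i] : i ∈ [n] }`, as a finite set. -/
noncomputable def PDA {A : Type*} (S : ℕ → A) (n : ℕ) (π : ℕ → ℕ) : Finset ℕ :=
  (Finset.Icc 1 n).image (fun i => i + LPF S n π i)

/-- The string `w` occurs in `S` starting at (1-based) position `i`. -/
def occursAt {A : Type*} (S : ℕ → A) (w : List A) (i : ℕ) : Prop :=
  ∀ (t : ℕ) (ht : t < w.length), S (i + t) = w.get ⟨t, ht⟩

/-- `w` is a substring of `S[1,n]`. -/
def IsSubstr {A : Type*} (S : ℕ → A) (n : ℕ) (w : List A) : Prop :=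
  ∃ i, 1 ≤ i ∧ i + w.length ≤ n + 1 ∧ occursAt S w i

/-- `w` is a suffix of the prefix `S[1,j]`. -/
def SuffixOfPrefix {A : Type*} (S : ℕ → A) (w : List A) (j : ℕ) : Prop :=
  w.length ≤ j ∧ occursAt S w (j - w.length + 1)

/-- `w` is a right-maximal substring of `S[1,n]`: it is a substring of `S[1,n]` and
either a suffix of `S[1,n]`, or it has two distinct one-character right-extensions
occurring in `S[1,n]`. -/
def RightMaximal {A : Type*} (S : ℕ → A) (n : ℕ) (w : List A) : Prop :=
  IsSubstr S n w ∧
    (SuffixOfPrefix S w n ∨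
      ∃ a b : A, a ≠ b ∧ IsSubstr S n (w ++ [a]) ∧ IsSubstr S n (w ++ [b]))

/-- `T[1,n]` is a text: `n ≥ 1` and the terminator `T n` is strictly smaller than
(in particular, different from) every other symbol of the text. -/
def IsText {A : Type*} [LT A] (T : ℕ → A) (n : ℕ) : Prop :=
  1 ≤ n ∧ ∀ i, 1 ≤ i → i < n → T n < T i

/-- The suffix `S[i,n]` as a list. -/
def sufList {A : Type*} (S : ℕ → A) (n i : ℕ) : List A :=
  (List.range (n + 1 - i)).map (fun t => S (i + t))

/-- The prefix `S[1,i]` as a list. -/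
def preList {A : Type*} (S : ℕ → A) (i : ℕ) : List A :=
  (List.range i).map (fun t => S (1 + t))

/-- `SA` is the suffix array of `T[1,n]`: a permutation of `[n]` listing the starting
positions of the suffixes of `T` in increasing lexicographic order. -/
def IsSA {A : Type*} [LinearOrder A] (T : ℕ → A) (n : ℕ) (SA : ℕ → ℕ) : Prop :=
  PermOn SA n ∧ ∀ i j, 1 ≤ i → i < j → j ≤ n →
    List.Lex (· < ·) (sufList T n (SA i)) (sufList T n (SA j))

/-- `g` is the inverse of `f` on `{1,…,n}`. -/
def IsInv (f g : ℕ → ℕ) (n : ℕ) : Prop :=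
  (∀ i, 1 ≤ i → i ≤ n → g (f i) = i) ∧ (∀ i, 1 ≤ i → i ≤ n → f (g i) = i)

/-- `PA` is the prefix array of `T[1,n]`: a permutation of `[n]` listing the ending
positions of the prefixes of `T` in increasing colexicographic order. -/
def IsPA {A : Type*} [LinearOrder A] (T : ℕ → A) (n : ℕ) (PA : ℕ → ℕ) : Prop :=
  PermOn PA n ∧ ∀ i j, 1 ≤ i → i < j → j ≤ n →
    List.Lex (· < ·) (preList T (PA i)).reverse (preList T (PA j)).reverse

/-- The Burrows–Wheeler transform: `BWT[i] = T[SA[i] - 1]`, with the convention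
`T[0] := T[n]`. -/
def BWT {A : Type*} (T : ℕ → A) (n : ℕ) (SA : ℕ → ℕ) (i : ℕ) : A :=
  T (if SA i = 1 then n else SA i - 1)

/-- The co-Burrows–Wheeler transform: `coBWT[i] = T[PA[i] + 1]`, with the convention
`T[n+1] := T[1]`. -/
def coBWT {A : Type*} (T : ℕ → A) (n : ℕ) (PA : ℕ → ℕ) (i : ℕ) : A :=
  T (if PA i = n then 1 else PA i + 1)

/-- Number of maximal equal-symbol runs of `B[1,n]` (for `n ≥ 1`). -/
noncomputable def runs {A : Type*} (B : ℕ → A) (n : ℕ) : ℕ :=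
  1 + ((Finset.Icc 2 n).filter (fun i => B i ≠ B (i - 1))).card

/-- The reducible-prefix length `ℓ_i` of the phrase starting at `i`: the largest
`ℓ ∈ {1,…,LPF_π[i]}` with `LPF_π[j] = LPF_π[j-1] - 1` for every `j ∈ [i+1, i+ℓ-1]`. -/
noncomputable def redLen {A : Type*} (S : ℕ → A) (n : ℕ) (π : ℕ → ℕ) (i : ℕ) : ℕ :=
  Nat.findGreatest
    (fun ℓ => 1 ≤ ℓ ∧ ∀ j, i + 1 ≤ j → j ≤ i + ℓ - 1 →
      (LPF S n π j : ℤ) = (LPF S n π (j - 1) : ℤ) - 1)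
    (LPF S n π i)

/-- Every secondary occurrence (a position `j` with `LPF_π[j] ≥ m`) of a
length-`m` pattern lies, in a unique way, inside a type-2 phrase with `j` in the phrase's
reducible prefix. -/
theorem secondary_unique_reducible_prefix {A : Type*} [Fintype A] [LinearOrder A]
    (T : ℕ → A) (n : ℕ) (htext : IsText T n)
    (π : ℕ → ℕ) (hperm : PermOn π n) (hop : OrderPres T n π)
    (m : ℕ) (hm : 1 ≤ m) :
    ∀ j, 1 ≤ j → j ≤ n → j + m - 1 ≤ n → m ≤ LPF T n π j →
      ∃! i, 1 ≤ i ∧ i ≤ n ∧ Irr T n π i ∧ 0 < LPF T n π i ∧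
        i ≤ j ∧ j ≤ i + redLen T n π i - 1 ∧ j + m - 1 ≤ i + LPF T n π i - 1 := by
  intro j hj1 hjn hjm hmL
  have key : ∀ d i, 1 ≤ i → i ≤ j → j - i = d →
      (∀ k, i + 1 ≤ k → k ≤ j → (LPF T n π k : ℤ) = (LPF T n π (k - 1) : ℤ) - 1) →
      LPF T n π i = LPF T n π j + d := by
    intro d
    induction d with
    | zero =>
      intro i _ h2 h3 _
      have : i = j := by omega
      subst this; rfl
    | succ d ih =>
      intro i h1 h2 h3 h4
      have a := ih (i + 1) (by omega) (by omega) (by omega) (fun k hk hk' => h4 k (by omega) hk')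
      have b := h4 (i + 1) le_rfl (by omega)
      simp only [Nat.add_sub_cancel] at b
      omega
  have hspec : ∀ i, 0 < LPF T n π i → ∀ k, i + 1 ≤ k → k ≤ i + redLen T n π i - 1 →
      (LPF T n π k : ℤ) = (LPF T n π (k - 1) : ℤ) - 1 := by
    intro i hi
    have := Nat.findGreatest_spec (P := fun ℓ => 1 ≤ ℓ ∧ ∀ j, i + 1 ≤ j → j ≤ i + ℓ - 1 →
      (LPF T n π j : ℤ) = (LPF T n π (j - 1) : ℤ) - 1) (m := 1) (n := LPF T n π i) hi
      ⟨le_rfl, fun k h1 h2 => by omega⟩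
    exact this.2
  have hex : ∃ i, 1 ≤ i ∧ i ≤ j ∧ Irr T n π i ∧
      ∀ k, i + 1 ≤ k → k ≤ j → ¬ Irr T n π k := by
    have h0 : (1 ≤ 1 ∧ Irr T n π 1) := ⟨le_rfl, Or.inl rfl⟩
    have hs := Nat.findGreatest_spec (P := fun i => 1 ≤ i ∧ Irr T n π i) hj1 h0
    refine ⟨_, hs.1, Nat.findGreatest_le j, hs.2, ?_⟩
    intro k hk hkj hI
    exact Nat.findGreatest_is_greatest (P := fun i => 1 ≤ i ∧ Irr T n π i)
      (by omega) hkj ⟨by omega, hI⟩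
  obtain ⟨i, hi1, hij, hI, hno⟩ := hex
  have hred : ∀ k, i + 1 ≤ k → k ≤ j →
      (LPF T n π k : ℤ) = (LPF T n π (k - 1) : ℤ) - 1 := by
    intro k h1 h2
    by_contra h
    exact hno k h1 h2 (Or.inr h)
  have hL := key (j - i) i hi1 hij rfl hred
  have hlen : j - i + 1 ≤ redLen T n π i := by
    apply Nat.le_findGreatest
    · omega
    · exact ⟨by omega, fun k h1 h2 => hred k h1 (by omega)⟩
  refine ⟨i, ⟨hi1, by omega, hI, by omega, hij, by omega, by omega⟩, ?_⟩
  rintro i' ⟨h1, _, hI', hpos, hle, hlen', _⟩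
  rcases lt_trichotomy i' i with h | h | h
  · rcases hI with hI | hI
    · omega
    · exact absurd (hspec i' hpos i (by omega) (by omega)) hI
  · exact h
  · exact absurd hI' (hno i' (by omega) hle)
end

section
/- Let p ≥ 1 and n ≥ x_1 > x_2 > ⋯ > x_p ≥ 1 be integers, and let S = 0^{x_1}·1·0^{x_2}·2⋯0^{x_p}·p be the string over the alphabet {0,1,…,p} obtained by concatenating, for t = 1,…,p, x_t copies of the symbol 0 followed by the symbol t. Then the irreducible LPF positions of S with respect to the identity permutation are exactly the positions in {1, 2} ∪ {i + 1 : 1 ≤ i < |S| and S[i] ≠ 0}, and there are exactly p + 1 of them. -/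
/-!
Common definitions: strings are modeled as functions `S : ℕ → A` with 1-based
positions `1,…,n`; patterns/substrings as `List A`.
-/

open scoped Classical

/-- View a list as a 1-based string over `ℕ`. -/
def listFun (L : List ℕ) : ℕ → ℕ := fun i => L.getD (i - 1) 0

/-- The string `0^{x₁}·1·0^{x₂}·2 ⋯ 0^{x_p}·p`. -/
def buildS (p : ℕ) (x : ℕ → ℕ) : List ℕ :=
  (List.range p).flatMap (fun t => List.replicate (x (t + 1)) 0 ++ [t + 1])

structure BInv (f : ℕ → ℕ) (N p X : ℕ) : Prop where
  le : ∀ q, f q ≤ p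
  inj : ∀ i j, f i ≠ 0 → f i = f j → i = j
  card : ((Finset.range N).filter (fun q => f q ≠ 0)).card = p
  last : N = 0 ∨ f (N - 1) ≠ 0
  run : ∀ i k, i + k ≤ N → (∀ t < k, f (i + t) = 0) → k ≤ X
  first : 1 ≤ p → ∀ j < X, f j = 0
  out : ∀ q, N ≤ q → f q = 0

lemma getD_step (L : List ℕ) (y c q : ℕ) :
    (L ++ (List.replicate y 0 ++ [c])).getD q 0 =
      if q < L.length then L.getD q 0 else if q = L.length + y then c else 0 := by
  split_ifs with h1 h2
  · rw [List.getD_append _ _ _ _ h1]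
  · subst h2
    simp [List.getD_eq_getElem?_getD]
  · rw [List.getD_append_right _ _ _ _ (by omega)]
    by_cases h : q - L.length < y
    · rw [List.getD_append _ _ _ _ (by simpa using h)]
      simp [List.getD_eq_getElem?_getD, h]
    · rw [List.getD_eq_default]
      simp
      omega

lemma BInv.step {f g : ℕ → ℕ} {N p X y : ℕ} (h : BInv f N p X) (hp0 : p = 0 → N = 0 ∧ y = X)
    (hy : y ≤ X)
    (hg : ∀ q, g q = if q < N then f q else if q = N + y then p + 1 else 0) :
    BInv g (N + (y + 1)) (p + 1) X := by
  obtain ⟨h1, h2, h3, h4, h5, h6, h7⟩ := h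
  refine ⟨?_, ?_, ?_, ?_, ?_, ?_, ?_⟩
  · intro q
    have := h1 q
    rw [hg]; split_ifs <;> omega
  · intro i j hi hij
    have a := h1 i
    have b := h1 j
    have c := h2 i j
    rw [hg] at hi
    rw [hg, hg] at hij
    split_ifs at hi hij <;> omega
  · have : (Finset.range (N + (y + 1))).filter (fun q => g q ≠ 0)
        = insert (N + y) ((Finset.range N).filter (fun q => f q ≠ 0)) := by
      ext q
      simp only [Finset.mem_filter, Finset.mem_range, Finset.mem_insert, hg]
      split_ifs <;> omega
    rw [this, Finset.card_insert_of_notMem (by simp), h3]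
  · right
    rw [hg]; split_ifs <;> omega
  · intro i k hik hz
    by_cases hi : i < N
    · apply h5 i k
      · by_contra hc
        have := hz (N - 1 - i) (by omega)
        rw [hg, if_pos (by omega), show i + (N - 1 - i) = N - 1 by omega] at this
        omega
      · intro t ht
        have := hz t ht
        by_cases hh : i + t < N
        · rwa [hg, if_pos hh] at this
        · exact h7 _ (by omega)
    · by_contra hc
      have := hz (N + y - i) (by omega)
      rw [hg, if_neg (by omega), if_pos (by omega)] at this
      omega
  · intro _ j hj
    rw [hg]
    by_cases hp : p = 0
    · obtain ⟨a, b⟩ := hp0 hp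
      rw [if_neg (by omega), if_neg (by omega)]
    · have hN : X ≤ N := by
        by_contra hc
        have : N ≠ 0 := by
          rintro rfl
          simp at h3; omega
        have := h6 (by omega) (N - 1) (by omega)
        omega
      rw [if_pos (by omega)]
      exact h6 (by omega) j hj
  · intro q hq
    rw [hg, if_neg (by omega), if_neg (by omega)]

lemma buildS_succ (p : ℕ) (x : ℕ → ℕ) :
    buildS (p + 1) x = buildS p x ++ (List.replicate (x (p + 1)) 0 ++ [p + 1]) := by
  simp [buildS, List.range_succ, List.flatMap_append]

lemma buildS_inv (x : ℕ → ℕ) (p : ℕ) (hx : ∀ t, 1 ≤ t → t ≤ p → x t ≤ x 1) :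
    BInv (fun q => (buildS p x).getD q 0) (buildS p x).length p (x 1) := by
  induction p with
  | zero =>
    refine ⟨?_, ?_, ?_, ?_, ?_, ?_, ?_⟩ <;> simp [buildS]
  | succ p ih =>
    have ih := ih (fun t h1 h2 => hx t h1 (by omega))
    have := ih.step (y := x (p + 1)) (g := fun q => (buildS (p + 1) x).getD q 0)
      (by rintro rfl; simp [buildS]) (hx _ (by omega) le_rfl)
      (by intro q; rw [buildS_succ]; exact getD_step _ _ _ _)
    have hl : (buildS (p + 1) x).length = (buildS p x).length + (x (p + 1) + 1) := by
      rw [buildS_succ]; simp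
    rw [hl]; exact this

lemma rlce_spec {A : Type*} (S : ℕ → A) (N i j : ℕ) (hi : i ≤ N + 1) (hj : j ≤ N + 1) :
    ∀ t < rlce S N i j, S (i + t) = S (j + t) := by
  have hsp := Nat.findGreatest_spec
      (P := fun k => i + k ≤ N + 1 ∧ j + k ≤ N + 1 ∧ ∀ t < k, S (i + t) = S (j + t))
      (m := 0) (n := N) (Nat.zero_le _) ⟨by omega, by omega, by simp⟩
  exact hsp.2.2

lemma le_rlce {A : Type*} (S : ℕ → A) (N i j k : ℕ) (hk : k ≤ N) (hi : i + k ≤ N + 1)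
    (hj : j + k ≤ N + 1) (h : ∀ t < k, S (i + t) = S (j + t)) : k ≤ rlce S N i j := by
  unfold rlce
  exact Nat.le_findGreatest hk ⟨hi, hj, h⟩

lemma LPF_eq {f : ℕ → ℕ} {S : ℕ → ℕ} {N p X : ℕ} (h : BInv f N p X) (hp : 1 ≤ p)
    (hS : ∀ i, S i = f (i - 1)) (i k : ℕ) (hi : 2 ≤ i) (hk : i + k ≤ N)
    (hz : ∀ t < k, S (i + t) = 0) (hn : S (i + k) ≠ 0) : LPF S N id i = k := by
  unfold LPF
  rw [if_neg (by simp; omega)]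
  have hkX : k ≤ X := by
    apply h.run (i - 1) k (by omega)
    intro t ht
    have := hz t ht
    rw [hS] at this
    rwa [show i - 1 + t = i + t - 1 by omega]
  apply le_antisymm
  · apply Finset.sup_le
    intro j hj
    simp only [Finset.mem_filter, Finset.mem_Icc, id] at hj
    by_contra hc
    have e := (rlce_spec S N j i (by omega) (by omega)) k (by omega)
    rw [hS, hS] at e
    rw [hS] at hn
    have := h.inj _ _ hn e.symm
    omega
  · refine le_trans ?_ (Finset.le_sup (f := fun j => rlce S N j i) (b := 1) ?_)
    · apply le_rlce S N 1 i k (by omega) (by omega) (by omega)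
      intro t ht
      rw [hz t ht, hS]
      exact h.first hp _ (by omega)
    · simp; omega

lemma exists_next {f : ℕ → ℕ} {S : ℕ → ℕ} {N p X : ℕ} (h : BInv f N p X)
    (hS : ∀ i, S i = f (i - 1)) (i : ℕ) (hi : 1 ≤ i) (hiN : i ≤ N) :
    ∃ k, i + k ≤ N ∧ (∀ t < k, S (i + t) = 0) ∧ S (i + k) ≠ 0 := by
  have hN : S (i + (N - i)) ≠ 0 := by
    rw [hS, show i + (N - i) - 1 = N - 1 by omega]
    have := h.last
    omega
  have hex : ∃ k, S (i + k) ≠ 0 := ⟨_, hN⟩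
  refine ⟨Nat.find hex, ?_, ?_, Nat.find_spec hex⟩
  · have := Nat.find_min' hex hN
    omega
  · intro t ht
    have := Nat.find_min hex ht
    simpa using this

theorem buildS_irreducible_positions (p n : ℕ) (hp : 1 ≤ p) (x : ℕ → ℕ)
    (hdec : ∀ s t, 1 ≤ s → s < t → t ≤ p → x t < x s)
    (hx1 : x 1 ≤ n) (hxp : 1 ≤ x p) :
    (∀ i, 1 ≤ i → i ≤ (buildS p x).length →
      (Irr (listFun (buildS p x)) (buildS p x).length id i ↔
        i = 1 ∨ i = 2 ∨ listFun (buildS p x) (i - 1) ≠ 0)) ∧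
    ((Finset.Icc 1 (buildS p x).length).filter
        (fun i => Irr (listFun (buildS p x)) (buildS p x).length id i)).card = p + 1 := by
  have hle : ∀ t, 1 ≤ t → t ≤ p → x t ≤ x 1 := by
    intro t h1 h2
    rcases Nat.eq_or_lt_of_le h1 with h | h
    · rw [h]
    · exact (hdec 1 t le_rfl h h2).le
  have hX : 1 ≤ x 1 := le_trans hxp (hle p hp le_rfl)
  have inv := buildS_inv x p hle
  have hS : ∀ i, listFun (buildS p x) i = (fun q => (buildS p x).getD q 0) (i - 1) :=
    fun i => rfl
  generalize listFun (buildS p x) = S at *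
  generalize (buildS p x).length = N at *
  generalize (fun q => (buildS p x).getD q 0) = f at *
  generalize x 1 = X at *
  have hf0 : f 0 = 0 := inv.first hp 0 (by omega)
  have hS1 : S 1 = 0 := by rw [hS]; exact hf0
  have hN2 : 2 ≤ N := by
    have h3 := inv.card
    have h4 := inv.last
    by_contra hc
    have : N = 0 ∨ N = 1 := by omega
    rcases this with rfl | rfl
    · simp at h3; omega
    · simp [hf0] at h4
  have main : ∀ i, 1 ≤ i → i ≤ N → (Irr S N id i ↔ i = 1 ∨ i = 2 ∨ S (i - 1) ≠ 0) := by
    intro i hi hiN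
    unfold Irr
    by_cases h1 : i = 1
    · simp [h1]
    by_cases h2 : i = 2
    · subst h2
      have : LPF S N id 1 = 0 := by simp [LPF]
      simp [this]
    obtain ⟨k, hk, hz, hn⟩ := exists_next inv hS i hi hiN
    have e := LPF_eq inv hp hS i k (by omega) hk hz hn
    by_cases h : S (i - 1) = 0
    · have e' := LPF_eq inv hp hS (i - 1) (k + 1) (by omega) (by omega)
        (by
          intro t ht
          rcases t with _ | t
          · simpa using h
          · rw [show i - 1 + (t + 1) = i + t by omega]
            exact hz t (by omega))
        (by rwa [show i - 1 + (k + 1) = i + k by omega])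
      rw [e, e']
      simp [h1, h2, h]
    · have e' := LPF_eq inv hp hS (i - 1) 0 (by omega) (by omega) (by simp) (by simpa using h)
      rw [e, e']
      simp [h1, h2, h]
  refine ⟨main, ?_⟩
  have hset : (Finset.Icc 1 N).filter (fun i => Irr S N id i) =
      insert 1 (insert 2 ((((Finset.range N).filter (fun q => f q ≠ 0)).erase (N - 1)).image
        (fun q => q + 2))) := by
    ext i
    simp only [Finset.mem_filter, Finset.mem_Icc, Finset.mem_insert, Finset.mem_image,
      Finset.mem_erase, Finset.mem_range]
    constructor
    · rintro ⟨⟨h1, h2⟩, h3⟩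
      rcases (main i h1 h2).1 h3 with h | h | h
      · exact Or.inl h
      · exact Or.inr (Or.inl h)
      · by_cases hi : i = 1
        · exact Or.inl hi
        · right; right
          rw [hS] at h
          exact ⟨i - 1 - 1, ⟨by omega, by omega, h⟩, by omega⟩
    · rintro (rfl | rfl | ⟨q, ⟨h1, h2, h3⟩, rfl⟩)
      · exact ⟨⟨le_rfl, by omega⟩, (main 1 le_rfl (by omega)).2 (Or.inl rfl)⟩
      · exact ⟨⟨by omega, by omega⟩, (main 2 (by omega) (by omega)).2 (Or.inr (Or.inl rfl))⟩
      · exact ⟨⟨by omega, by omega⟩, (main (q + 2) (by omega) (by omega)).2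
          (Or.inr (Or.inr (by rw [hS]; exact h3)))⟩
  rw [hset, Finset.card_insert_of_notMem, Finset.card_insert_of_notMem,
    Finset.card_image_of_injective, Finset.card_erase_of_mem, inv.card]
  · omega
  · have := inv.last
    simp only [Finset.mem_filter, Finset.mem_range]
    omega
  · intro a b hab
    simpa using hab
  · simp [hf0]
  · simp
end

section
/- Let T be a text of length n over a finite totally ordered alphabet Σ and let LPF be the generalized Longest Previous Factor array of T with respect to the identity permutation. Then i + LPF[i] ≤ n for every i ∈ [n], and for every j ∈ {i + LPF[i] : i ∈ [n]} with j > 1 the following holds: letting i' := min{ k ∈ [1, j] : T[k, j−1] occurs as a substring of T[1, j−2] } (this minimum exists, since T[j, j−1] is the empty string, which is a substring of every string), the string T[i', j] does not occur as a substring of T[1, j−1]. (Equivalently, st-pos^- is contained in {1} together with the set of positions at which the simple PPM* algorithm with unbounded contexts emits an escape symbol.) -/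
/-!
Common definitions: strings are modeled as functions `S : ℕ → A` with 1-based
positions `1,…,n`; patterns/substrings as `List A`.
-/

open scoped Classical

/-- The substring `S[a,b]` as a list (empty if `b < a`). -/
def seg {A : Type*} (S : ℕ → A) (a b : ℕ) : List A :=
  (List.range (b + 1 - a)).map (fun t => S (a + t))

/-- `w` occurs in the prefix `S[1,m]`. -/
def OccursIn {A : Type*} (S : ℕ → A) (w : List A) (m : ℕ) : Prop :=
  ∃ s, 1 ≤ s ∧ s + w.length ≤ m + 1 ∧ occursAt S w s

theorem lpf_wit {A : Type*} (T : ℕ → A) (n i : ℕ) (h1 : 2 ≤ i) (hn : i ≤ n) :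
    ∃ p, 1 ≤ p ∧ p < i ∧ i + LPF T n id i ≤ n + 1 ∧
      ∀ t < LPF T n id i, T (p + t) = T (i + t) := by
  have hne : ((Finset.Icc 1 n).filter (fun j => id j < id i)).Nonempty :=
    ⟨1, by simp; omega⟩
  obtain ⟨p, hp, he⟩ := Finset.exists_mem_eq_sup _ hne (fun j => rlce T n j i)
  have hL : LPF T n id i = rlce T n p i := by
    unfold LPF
    rw [if_neg (by simp; omega), he]
  simp only [Finset.mem_filter, Finset.mem_Icc, id] at hp
  have := Nat.findGreatest_spec
    (P := fun k => p + k ≤ n + 1 ∧ i + k ≤ n + 1 ∧ ∀ t < k, T (p + t) = T (i + t))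
    (n := n) (m := 0) (Nat.zero_le _) ⟨by omega, by omega, by intro t ht; omega⟩
  rw [hL]
  exact ⟨p, hp.1.1, hp.2, this.2.1, this.2.2⟩

theorem lpf_ge {A : Type*} (T : ℕ → A) (n i p k : ℕ) (hp : 1 ≤ p) (hpi : p < i)
    (hn : i + k ≤ n + 1) (h : ∀ t < k, T (p + t) = T (i + t)) (hin : i ≤ n) :
    k ≤ LPF T n id i := by
  unfold LPF
  rw [if_neg (by simp; omega)]
  have hm : p ∈ (Finset.Icc 1 n).filter (fun j => id j < id i) := by
    simp; omega
  refine le_trans ?_ (Finset.le_sup (f := fun j => rlce T n j i) hm)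
  exact Nat.le_findGreatest (by omega) ⟨by omega, hn, h⟩

theorem occ_seg {A : Type*} (T : ℕ → A) (a b m : ℕ) :
    OccursIn T (seg T a b) m ↔
      ∃ s, 1 ≤ s ∧ s + (b + 1 - a) ≤ m + 1 ∧ ∀ t < b + 1 - a, T (s + t) = T (a + t) := by
  simp [OccursIn, occursAt, seg]

/-- For a text `T[1,n]` and LPF w.r.t. the identity permutation:
`i + LPF[i] ≤ n` for all `i ∈ [n]`, and every `j ∈ st-pos⁻` with `j > 1` is a position
where the simple PPM* algorithm emits an escape: with
`i' = min{ k ∈ [1,j] : T[k,j-1] occurs in T[1,j-2] }`, the string `T[i',j]` does not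
occur in `T[1,j-1]`. -/
theorem stpos_subset_PPM_escapes {A : Type*} [Fintype A] [LinearOrder A]
    (T : ℕ → A) (n : ℕ) (htext : IsText T n) :
    (∀ i, 1 ≤ i → i ≤ n → i + LPF T n id i ≤ n) ∧
    (∀ j, (∃ i, 1 ≤ i ∧ i ≤ n ∧ j = i + LPF T n id i) → 1 < j →
      ¬ OccursIn T
          (seg T (sInf {k | 1 ≤ k ∧ k ≤ j ∧ OccursIn T (seg T k (j - 1)) (j - 2)}) j)
          (j - 1)) := by
  have h1 : ∀ i, 1 ≤ i → i ≤ n → i + LPF T n id i ≤ n := by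
    intro i hi hn
    by_cases h : i = 1
    · simp [LPF, h, htext.1]
    · obtain ⟨p, hp, hpi, hle, hm⟩ := lpf_wit T n i (by omega) hn
      by_contra hc
      have h2 := hm (LPF T n id i - 1) (by omega)
      have h3 := htext.2 (p + (LPF T n id i - 1)) (by omega) (by omega)
      rw [h2, show i + (LPF T n id i - 1) = n by omega] at h3
      exact lt_irrefl _ h3
  refine ⟨h1, ?_⟩
  rintro j ⟨i, hi, hn, hj⟩ hj1 hocc
  have hi2 : 2 ≤ i := by
    by_contra hc
    have : i = 1 := by omega
    subst this
    simp [LPF] at hj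
    omega
  have hjn := h1 i hi hn
  obtain ⟨p, hp, hpi, hle, hm⟩ := lpf_wit T n i hi2 hn
  have hmem : i ∈ {k | 1 ≤ k ∧ k ≤ j ∧ OccursIn T (seg T k (j - 1)) (j - 2)} := by
    refine ⟨hi, by omega, (occ_seg _ _ _ _).2 ⟨p, hp, by omega, fun t ht => hm t (by omega)⟩⟩
  have hle' := Nat.sInf_le hmem
  set q := sInf {k | 1 ≤ k ∧ k ≤ j ∧ OccursIn T (seg T k (j - 1)) (j - 2)}
  obtain ⟨s, hs, hsl, hst⟩ := (occ_seg _ _ _ _).1 hocc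
  have := lpf_ge T n i (s + (i - q)) (LPF T n id i + 1) (by omega) (by omega) (by omega) (by
    intro t ht
    have := hst (i - q + t) (by omega)
    rwa [← Nat.add_assoc, ← Nat.add_assoc, Nat.add_sub_cancel' hle'] at this) hn
  omega
end
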